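/- If G : {0,1}* → ℕ is of the form G(p) = index(W^A_{g(p)}) for a partial A-recursive g (defined only when g(p) converges and W^A_{g(p)} is an equivalence relation of finite index), then the set G⁻¹(0) is the intersection of a Σ⁰₁(A) set and a Π⁰₁(A) set. Consequently, the characteristic function of a Δ⁰₂(A) set that is not a Boolean combination of Σ⁰₁(A) sets is not of this form, even though it is A′-recursive. -/

import Mathlib

/-- Codes for oracle partial recursive functions: `Nat.Partrec.Code` with an
extra constructor for one call to the oracle. -/
inductive OCode : Type
  | zero | succ | left | right | oracle
  | pair : OCode → OCode → OCode
  | comp : OCode → OCode → OCode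
  | prec : OCode → OCode → OCode
  | rfind' : OCode → OCode

/-- Evaluation of an oracle code, relative to the oracle `O`. -/
def evalo (O : ℕ →. ℕ) : OCode → ℕ →. ℕ
  | .zero => fun _ => Part.some 0
  | .succ => fun n => Part.some (n + 1)
  | .left => fun n => Part.some (Nat.unpair n).1
  | .right => fun n => Part.some (Nat.unpair n).2
  | .oracle => O
  | .pair cf cg => fun n => Nat.pair <$> evalo O cf n <*> evalo O cg n
  | .comp cf cg => fun n => evalo O cg n >>= evalo O cf
  | .prec cf cg => Nat.unpaired fun a n =>
      n.rec (evalo O cf a) fun y IH => do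
        let i ← IH
        evalo O cg (Nat.pair a (Nat.pair y i))
  | .rfind' cf => Nat.unpaired fun a m =>
      (Nat.rfind fun n => (fun x => x = 0) <$> evalo O cf (Nat.pair a (n + m))).map (· + m)

open Classical in
/-- The characteristic (total) partial function of a set of naturals. -/
noncomputable def chi (A : Set ℕ) : ℕ →. ℕ :=
  fun n => Part.some (if n ∈ A then 1 else 0)

/-- `f` is partial `A`-recursive (via encodings of `α` and `β`). -/
def RecInP {α β : Type*} [Primcodable α] [Primcodable β] (A : Set ℕ) (f : α →. β) : Prop :=
  ∃ c : OCode, ∀ a : α,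
    evalo (chi A) c (Encodable.encode a) = (f a).map Encodable.encode

/-- An injective encoding of oracle codes into ℕ. -/
def encOCode : OCode → ℕ
  | .zero => 0
  | .succ => 1
  | .left => 2
  | .right => 3
  | .oracle => 4
  | .pair a b => 4 * Nat.pair (encOCode a) (encOCode b) + 5
  | .comp a b => 4 * Nat.pair (encOCode a) (encOCode b) + 6
  | .prec a b => 4 * Nat.pair (encOCode a) (encOCode b) + 7
  | .rfind' a => 4 * encOCode a + 8

/-- The Turing jump A′ of A : the self-halting set relative to A. -/
def jump (A : Set ℕ) : Set ℕ :=
  {n | ∃ c : OCode, encOCode c = n ∧ (evalo (chi A) c n).Dom}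

/-- The acceptable enumeration of A-r.e. subsets of ℕ: `W A e` is the domain of the
A-partial recursive function coded by `e`. -/
def W (A : Set ℕ) (e : ℕ) : Set ℕ :=
  {n | ∃ c : OCode, encOCode c = e ∧ (evalo (chi A) c n).Dom}

/-- The acceptable enumeration of A-r.e. subsets of ℕ². -/
def W2 (A : Set ℕ) (e : ℕ) : Set (ℕ × ℕ) :=
  {x | ∃ c : OCode, encOCode c = e ∧ (evalo (chi A) c (Nat.pair x.1 x.2)).Dom}

/-- `E` is an equivalence relation on its field. -/
def IsEqvRel (E : Set (ℕ × ℕ)) : Prop :=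
  (∀ x y, (x, y) ∈ E → (x, x) ∈ E ∧ (y, x) ∈ E) ∧
  (∀ x y z, (x, y) ∈ E → (y, z) ∈ E → (x, z) ∈ E)

/-- The set of equivalence classes of `E`. -/
def eqvClasses (E : Set (ℕ × ℕ)) : Set (Set ℕ) :=
  {C | ∃ x, (x, x) ∈ E ∧ C = {y | (x, y) ∈ E}}

/-- `E` is an equivalence relation on its field with finitely many classes. -/
def FiniteIndexEqv (E : Set (ℕ × ℕ)) : Prop := IsEqvRel E ∧ (eqvClasses E).Finite

/-- The index of `E` as a partial value: the number of equivalence classes,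
defined only when `E` is an equivalence relation of finite index. -/
noncomputable def pindex (E : Set (ℕ × ℕ)) : Part ℕ :=
  ⟨FiniteIndexEqv E, fun _ => (eqvClasses E).ncard⟩

/-- `G(p) = index(W^A_{g(p)})`, defined when `g(p)` converges and the coded set
is an equivalence relation of finite index. -/
noncomputable def Gidx (A : Set ℕ) (g : List Bool →. ℕ) : List Bool →. ℕ :=
  fun p => (g p).bind fun e => pindex (W2 A e)

/-- Boolean combinations of a collection of sets. -/
inductive BoolComb {α : Type*} (C : Set (Set α)) : Set α → Prop
  | base {S : Set α} : S ∈ C → BoolComb C S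
  | compl {S : Set α} : BoolComb C S → BoolComb C Sᶜ
  | union {S T : Set α} : BoolComb C S → BoolComb C T → BoolComb C (S ∪ T)

/-- The Σ⁰₁(A) subsets of {0,1}*. -/
def Sigma01 (A : Set ℕ) : Set (Set (List Bool)) :=
  {S | ∃ f : List Bool →. Unit, RecInP A f ∧ S = {p | (f p).Dom}}

theorem mem_evalo_comp {O : ℕ →. ℕ} {a b : OCode} {x v : ℕ} :
    v ∈ evalo O (.comp a b) x ↔ ∃ u ∈ evalo O b x, v ∈ evalo O a u := Part.mem_bind_iff

theorem mem_evalo_prec_succ {O : ℕ →. ℕ} {a b : OCode} {x n v : ℕ} :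
    v ∈ evalo O (.prec a b) (Nat.pair x (n + 1)) ↔
      ∃ u ∈ evalo O (.prec a b) (Nat.pair x n), v ∈ evalo O b (Nat.pair x (Nat.pair n u)) := by
  simp only [evalo, Nat.unpaired, Nat.unpair_pair]
  exact Part.mem_bind_iff

theorem evalo_prec_zero (O : ℕ →. ℕ) (a b : OCode) (x : ℕ) :
    evalo O (.prec a b) (Nat.pair x 0) = evalo O a x := by
  simp [evalo]

theorem evalo_comp_of_eq {O : ℕ →. ℕ} {b : OCode} {x u : ℕ} (a : OCode)
    (h : evalo O b x = Part.some u) : evalo O (.comp a b) x = evalo O a u := by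
  ext v
  simp [mem_evalo_comp, h]

theorem evalo_pair_of_eq {O : ℕ →. ℕ} {a b : OCode} {x u w : ℕ}
    (ha : evalo O a x = Part.some u) (hb : evalo O b x = Part.some w) :
    evalo O (.pair a b) x = Part.some (Nat.pair u w) := by
  simp [evalo, Seq.seq, ha, hb]

theorem mem_evalo_rfind' {O : ℕ →. ℕ} {a : OCode} {x v : ℕ} :
    v ∈ evalo O (.rfind' a) x ↔
      ∃ n, (0 ∈ evalo O a (Nat.pair x.unpair.1 (n + x.unpair.2)) ∧
        ∀ m < n, ∃ w ∈ evalo O a (Nat.pair x.unpair.1 (m + x.unpair.2)), w ≠ 0) ∧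
        n + x.unpair.2 = v := by
  refine (Part.mem_map_iff _).trans (exists_congr fun n => and_congr_left fun _ => ?_)
  refine Nat.mem_rfind.trans (and_congr ?_ (forall₂_congr fun m _ => ?_))
  · exact (Part.mem_map_iff _).trans (by simp)
  · exact (Part.mem_map_iff _).trans (by simp)

theorem encOCode_surjective (e : ℕ) : ∃ c : OCode, encOCode c = e := by
  induction e using Nat.strong_induction_on with
  | _ e ih =>
    by_cases h : e < 5
    · interval_cases e
      exacts [⟨.zero, rfl⟩, ⟨.succ, rfl⟩, ⟨.left, rfl⟩, ⟨.right, rfl⟩, ⟨.oracle, rfl⟩]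
    · have hq : (e - 5) / 4 < e := by omega
      obtain ⟨a, ha⟩ := ih _ ((Nat.unpair_left_le _).trans_lt hq)
      obtain ⟨b, hb⟩ := ih _ ((Nat.unpair_right_le _).trans_lt hq)
      obtain ⟨c, hc⟩ := ih _ hq
      have hr : (e - 5) % 4 < 4 := Nat.mod_lt _ (by norm_num)
      have hab : Nat.pair (encOCode a) (encOCode b) = (e - 5) / 4 := by
        rw [ha, hb, Nat.pair_unpair]
      interval_cases hm : (e - 5) % 4
      · exact ⟨.pair a b, by simp only [encOCode, hab]; omega⟩
      · exact ⟨.comp a b, by simp only [encOCode, hab]; omega⟩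
      · exact ⟨.prec a b, by simp only [encOCode, hab]; omega⟩
      · exact ⟨.rfind' c, by simp only [encOCode, hc]; omega⟩

/-- If every value of `O` is eventually a value of `P M`, then every value computed
with oracle `O` is eventually computed with oracle `P M`. -/
theorem evalo_eventually {ι : Type*} {l : Filter ι} {O : ℕ →. ℕ} {P : ι → ℕ →. ℕ}
    (h : ∀ x v, v ∈ O x → ∀ᶠ M in l, v ∈ P M x) (c : OCode) :
    ∀ x v, v ∈ evalo O c x → ∀ᶠ M in l, v ∈ evalo (P M) c x := by
  induction c with
  | zero => exact fun x v hv => .of_forall fun _ => hv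
  | succ => exact fun x v hv => .of_forall fun _ => hv
  | left => exact fun x v hv => .of_forall fun _ => hv
  | right => exact fun x v hv => .of_forall fun _ => hv
  | oracle => exact h
  | pair a b iha ihb =>
    intro x v hv
    simp only [evalo, Seq.seq, Part.map_eq_map, Part.mem_bind_iff, Part.mem_map_iff] at hv ⊢
    obtain ⟨f, ⟨u, hu, rfl⟩, w, hw, rfl⟩ := hv
    filter_upwards [iha _ _ hu, ihb _ _ hw] with M h1 h2
    exact ⟨_, ⟨u, h1, rfl⟩, w, h2, rfl⟩
  | comp a b iha ihb =>
    intro x v hv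
    simp only [mem_evalo_comp] at hv ⊢
    obtain ⟨u, hu, hv⟩ := hv
    filter_upwards [ihb _ _ hu, iha _ _ hv] with M h1 h2
    exact ⟨u, h1, h2⟩
  | prec a b iha ihb =>
    intro x
    obtain ⟨x, n, rfl⟩ : ∃ y n, x = Nat.pair y n := ⟨_, _, (Nat.pair_unpair x).symm⟩
    induction n with
    | zero => simpa only [evalo_prec_zero] using iha x
    | succ n ih =>
      intro v hv
      simp only [mem_evalo_prec_succ] at hv ⊢
      obtain ⟨u, hu, hv⟩ := hv
      filter_upwards [ih _ hu, ihb _ _ hv] with M h1 h2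
      exact ⟨u, h1, h2⟩
  | rfind' a iha =>
    intro x v hv
    simp only [mem_evalo_rfind'] at hv ⊢
    obtain ⟨n, ⟨hu, hlt⟩, rfl⟩ := hv
    have hall : ∀ᶠ M in l, ∀ m ∈ Set.Iio n, ∃ w ∈ evalo (P M) a
        (Nat.pair x.unpair.1 (m + x.unpair.2)), w ≠ 0 := by
      refine (Filter.eventually_all_finite (Set.finite_Iio n)).2 fun m hm => ?_
      obtain ⟨w, hw, hw0⟩ := hlt m hm
      filter_upwards [iha _ _ hw] with M hM
      exact ⟨w, hM, hw0⟩
    filter_upwards [iha _ _ hu, hall] with M h1 h2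
    exact ⟨n, ⟨h1, h2⟩, rfl⟩

theorem evalo_mono {O O' : ℕ →. ℕ} (h : ∀ x v, v ∈ O x → v ∈ O' x) (c : OCode) {x v : ℕ}
    (hv : v ∈ evalo O c x) : v ∈ evalo O' c x := by
  simpa using evalo_eventually (l := (pure () : Filter Unit)) (P := fun _ => O')
    (by simpa using h) c x v hv

open Nat.Partrec (Code)

/-- An oracle code with the oracle replaced by the ordinary code `o`. -/
def OCode.toCode (o : Code) : OCode → Code
  | .zero => .zero
  | .succ => .succ
  | .left => .left
  | .right => .right
  | .oracle => o
  | .pair a b => .pair (a.toCode o) (b.toCode o)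
  | .comp a b => .comp (a.toCode o) (b.toCode o)
  | .prec a b => .prec (a.toCode o) (b.toCode o)
  | .rfind' a => .rfind' (a.toCode o)

theorem OCode.eval_toCode (o : Code) (c : OCode) : (c.toCode o).eval = evalo o.eval c := by
  induction c with
  | pair a b iha ihb => simp only [toCode, Code.eval, evalo, iha, ihb]; rfl
  | comp a b iha ihb => simp only [toCode, Code.eval, evalo, iha, ihb]; rfl
  | prec a b iha ihb => simp only [toCode, Code.eval, evalo, iha, ihb]; rfl
  | rfind' a iha => simp only [toCode, Code.eval, evalo, iha]; rfl
  | _ => rfl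

/-- Ordinary codes are oracle codes. -/
def OCode.ofCode : Code → OCode
  | .zero => .zero
  | .succ => .succ
  | .left => .left
  | .right => .right
  | .pair a b => .pair (ofCode a) (ofCode b)
  | .comp a b => .comp (ofCode a) (ofCode b)
  | .prec a b => .prec (ofCode a) (ofCode b)
  | .rfind' a => .rfind' (ofCode a)

theorem OCode.evalo_ofCode (O : ℕ →. ℕ) (c : Code) : evalo O (ofCode c) = c.eval := by
  induction c with
  | pair a b iha ihb => simp only [ofCode, Code.eval, evalo, iha, ihb]; rfl
  | comp a b iha ihb => simp only [ofCode, Code.eval, evalo, iha, ihb]; rfl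
  | prec a b iha ihb => simp only [ofCode, Code.eval, evalo, iha, ihb]; rfl
  | rfind' a iha => simp only [ofCode, Code.eval, evalo, iha]; rfl
  | _ => rfl

/-- The action of `OCode.toCode o` on encodings of oracle codes. -/
def toCodeNat (o : Code) : ℕ → Code
  | 0 => .zero
  | 1 => .succ
  | 2 => .left
  | 3 => .right
  | 4 => o
  | m + 5 =>
    have h0 : m / 4 < m + 5 := by omega
    have h1 : (m / 4).unpair.1 < m + 5 := (Nat.unpair_left_le _).trans_lt h0
    have h2 : (m / 4).unpair.2 < m + 5 := (Nat.unpair_right_le _).trans_lt h0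
    if m % 4 = 0 then .pair (toCodeNat o (m / 4).unpair.1) (toCodeNat o (m / 4).unpair.2)
    else if m % 4 = 1 then .comp (toCodeNat o (m / 4).unpair.1) (toCodeNat o (m / 4).unpair.2)
    else if m % 4 = 2 then .prec (toCodeNat o (m / 4).unpair.1) (toCodeNat o (m / 4).unpair.2)
    else .rfind' (toCodeNat o (m / 4))

theorem toCodeNat_encOCode (o : Code) (c : OCode) :
    toCodeNat o (encOCode c) = c.toCode o := by
  have d (q r : ℕ) (h : r < 4) : (4 * q + r) / 4 = q ∧ (4 * q + r) % 4 = r := by omega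
  induction c with
  | pair a b iha ihb =>
    simp [encOCode, toCodeNat, OCode.toCode, iha, ihb]
  | comp a b iha ihb =>
    obtain ⟨h1, h2⟩ := d (Nat.pair (encOCode a) (encOCode b)) 1 (by norm_num)
    change toCodeNat o (4 * Nat.pair (encOCode a) (encOCode b) + 1 + 5) = _
    rw [toCodeNat, h1, h2]
    simp [OCode.toCode, iha, ihb]
  | prec a b iha ihb =>
    obtain ⟨h1, h2⟩ := d (Nat.pair (encOCode a) (encOCode b)) 2 (by norm_num)
    change toCodeNat o (4 * Nat.pair (encOCode a) (encOCode b) + 2 + 5) = _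
    rw [toCodeNat, h1, h2]
    simp [OCode.toCode, iha, ihb]
  | rfind' a iha =>
    obtain ⟨h1, h2⟩ := d (encOCode a) 3 (by norm_num)
    change toCodeNat o (4 * encOCode a + 3 + 5) = _
    rw [toCodeNat, h1, h2]
    simp [OCode.toCode, iha]
  | _ => simp [encOCode, toCodeNat, OCode.toCode]

theorem primrec_toCodeNat : Primrec₂ toCodeNat := by
  let at' : List Code → ℕ → Code := fun l n => l.getD n .zero
  let g : Code → List Code → Code := fun o l =>
    if l.length = 0 then .zero else if l.length = 1 then .succ
    else if l.length = 2 then .left else if l.length = 3 then .right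
    else if l.length = 4 then o
    else if (l.length - 5) % 4 = 0 then
      .pair (at' l ((l.length - 5) / 4).unpair.1) (at' l ((l.length - 5) / 4).unpair.2)
    else if (l.length - 5) % 4 = 1 then
      .comp (at' l ((l.length - 5) / 4).unpair.1) (at' l ((l.length - 5) / 4).unpair.2)
    else if (l.length - 5) % 4 = 2 then
      .prec (at' l ((l.length - 5) / 4).unpair.1) (at' l ((l.length - 5) / 4).unpair.2)
    else .rfind' (at' l ((l.length - 5) / 4))
  have hlen : Primrec fun p : Code × List Code => p.2.length :=
    Primrec.list_length.comp Primrec.snd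
  have hsub := Primrec.nat_sub.comp hlen (Primrec.const 5)
  have hmod := Primrec.nat_mod.comp hsub (Primrec.const 4)
  have hdiv := Primrec.nat_div.comp hsub (Primrec.const 4)
  have hunp := Primrec.unpair.comp hdiv
  have hat : Primrec₂ at' := Primrec.list_getD _
  have ha := hat.comp Primrec.snd (Primrec.fst.comp hunp)
  have hb := hat.comp Primrec.snd (Primrec.snd.comp hunp)
  have hc := hat.comp Primrec.snd hdiv
  have heq {f : Code × List Code → ℕ} (hf : Primrec f) (n : ℕ) :
      PrimrecPred fun p => f p = n := Primrec.eq.comp hf (Primrec.const n)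
  have hg : Primrec₂ g :=
    Primrec.ite (heq hlen 0) (Primrec.const _) <| Primrec.ite (heq hlen 1) (Primrec.const _) <|
    Primrec.ite (heq hlen 2) (Primrec.const _) <| Primrec.ite (heq hlen 3) (Primrec.const _) <|
    Primrec.ite (heq hlen 4) Primrec.fst <|
    Primrec.ite (heq hmod 0) (Code.primrec₂_pair.comp ha hb) <|
    Primrec.ite (heq hmod 1) (Code.primrec₂_comp.comp ha hb) <|
    Primrec.ite (heq hmod 2) (Code.primrec₂_prec.comp ha hb) <|
    Code.primrec_rfind'.comp hc
  refine Primrec.nat_strong_rec _ (g := fun o l => some (g o l)) (Primrec.option_some.comp hg) ?_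
  intro o n
  have hat' {m : ℕ} (hm : m < n) :
      at' ((List.range n).map (toCodeNat o)) m = toCodeNat o m := by
    simp [at', List.getD_eq_getElem?_getD, hm]
  match n with
  | 0 | 1 | 2 | 3 | 4 => simp [g, toCodeNat]
  | m + 5 =>
    have h0 : m / 4 < m + 5 := by omega
    have h1 : (m / 4).unpair.1 < m + 5 := (Nat.unpair_left_le _).trans_lt h0
    have h2 : (m / 4).unpair.2 < m + 5 := (Nat.unpair_right_le _).trans_lt h0
    simp only [g, List.length_map, List.length_range, Nat.add_sub_cancel, hat' h0, hat' h1,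
      hat' h2]
    rw [toCodeNat]
    simp

/-- The initial segment of length `n` of the characteristic function of `A`, in reverse. -/
noncomputable def chiList (A : Set ℕ) : ℕ → List ℕ
  | 0 => []
  | n + 1 => (open Classical in if n ∈ A then 1 else 0) :: chiList A n

theorem chiList_length (A : Set ℕ) (n : ℕ) : (chiList A n).length = n := by
  induction n with
  | zero => rfl
  | succ n ih => simp [chiList, ih]

open Classical in
theorem chiList_reverse_getElem? (A : Set ℕ) (n x : ℕ) :
    (chiList A n).reverse[x]? = if x < n then some (if x ∈ A then 1 else 0) else none := by
  induction n with
  | zero => simp [chiList]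
  | succ n ih =>
    rw [chiList, List.reverse_cons, List.getElem?_append]
    simp only [List.length_reverse, chiList_length, ih]
    rcases lt_trichotomy x n with h | rfl | h
    · simp [h, h.trans (Nat.lt_succ_self n)]
    · simp
    · have h1 : ¬ x < n := by omega
      have h2 : ¬ x < n + 1 := by omega
      have h3 : x - n ≠ 0 := by omega
      simp [h1, h2, h3]

theorem exists_evalo_chiList (A : Set ℕ) :
    ∃ c, ∀ n, evalo (chi A) c n = Part.some (Encodable.encode (chiList A n)) := by
  let s : OCode := .comp .succ (.pair (.comp .oracle (.comp .left .right)) (.comp .right .right))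
  have hs (x n i : ℕ) : evalo (chi A) s (Nat.pair x (Nat.pair n i)) =
      Part.some (Nat.pair (open Classical in if n ∈ A then 1 else 0) i + 1) := by
    have hr : evalo (chi A) .right (Nat.pair x (Nat.pair n i)) = Part.some (Nat.pair n i) := by
      simp [evalo]
    have h1 : evalo (chi A) (.comp .left .right) (Nat.pair x (Nat.pair n i)) = Part.some n := by
      rw [evalo_comp_of_eq _ hr]
      simp [evalo]
    have h2 : evalo (chi A) (.comp .right .right) (Nat.pair x (Nat.pair n i)) = Part.some i := by
      rw [evalo_comp_of_eq _ hr]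
      simp [evalo]
    exact evalo_comp_of_eq _ (evalo_pair_of_eq (evalo_comp_of_eq _ h1) h2)
  have hp (x n : ℕ) : evalo (chi A) (.prec .zero s) (Nat.pair x n) =
      Part.some (Encodable.encode (chiList A n)) := by
    induction n with
    | zero => rw [evalo_prec_zero]; rfl
    | succ n ih =>
      ext v
      simp [mem_evalo_prec_succ, ih, hs, chiList]
  have hid (n : ℕ) : evalo (chi A) (.pair .left .right) n = Part.some n := by
    rw [evalo_pair_of_eq rfl rfl, Nat.pair_unpair]
  refine ⟨.comp (.prec .zero s) (.pair .zero (.pair .left .right)), fun n => ?_⟩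
  rw [evalo_comp_of_eq _ (evalo_pair_of_eq rfl (hid n)), hp]

/-- There is a code looking up a position in a reversed list of values. -/
theorem exists_code_lookup :
    ∃ lk : Code, ∀ (l : List ℕ) x,
      lk.eval (Nat.pair (Encodable.encode l) x) = (l.reverse[x]? : Option ℕ) := by
  have h : Partrec fun p : List ℕ × ℕ => ((p.1.reverse[p.2]? : Option ℕ) : Part ℕ) :=
    Computable.ofOption (Primrec.to_comp (Primrec.list_getElem?.comp
      (Primrec.list_reverse.comp Primrec.fst) Primrec.snd))
  obtain ⟨lk, hlk⟩ := Code.exists_code.1 h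
  refine ⟨lk, fun l x => ?_⟩
  have := congrFun hlk (Nat.pair (Encodable.encode l) x)
  rw [this, ← Encodable.encode_nat x, ← Encodable.encode_prod_val, Encodable.encodek,
    Part.coe_some, Part.bind_some, Encodable.encode_nat]
  exact Part.map_id' (fun _ => rfl) _

theorem exists_toCode_dom_iff (A : Set ℕ) {lk : Code}
    (hlk : ∀ (l : List ℕ) x,
      lk.eval (Nat.pair (Encodable.encode l) x) = (l.reverse[x]? : Option ℕ)) (c : OCode) (x : ℕ) :
    (evalo (chi A) c x).Dom ↔ ∃ M k, (Code.evaln k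
      (c.toCode (lk.curry (Encodable.encode (chiList A M)))) x).isSome := by
  have ho (M y : ℕ) : (lk.curry (Encodable.encode (chiList A M))).eval y
      = ((chiList A M).reverse[y]? : Option ℕ) := by rw [Code.eval_curry, hlk]
  constructor
  · intro h
    obtain ⟨v, hv⟩ := Part.dom_iff_mem.1 h
    have hev := evalo_eventually (l := Filter.atTop)
      (P := fun M => (lk.curry (Encodable.encode (chiList A M))).eval) (fun y w hw => by
        filter_upwards [Filter.eventually_gt_atTop y] with M hM
        rw [ho, chiList_reverse_getElem?, if_pos hM]
        simpa [chi] using hw) c x v hv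
    obtain ⟨M, hM⟩ := hev.exists
    rw [← OCode.eval_toCode] at hM
    obtain ⟨k, hk⟩ := Code.evaln_complete.1 hM
    exact ⟨M, k, Option.isSome_iff_exists.2 ⟨v, hk⟩⟩
  · rintro ⟨M, k, h⟩
    obtain ⟨v, hv⟩ := Option.isSome_iff_exists.1 h
    have hv := Code.evaln_sound hv
    rw [OCode.eval_toCode] at hv
    refine Part.dom_iff_mem.2 ⟨v, evalo_mono (fun y w hw => ?_) c hv⟩
    rw [ho, chiList_reverse_getElem?] at hw
    split_ifs at hw <;> simp_all [chi]

/-- Nonemptiness of the `A`-r.e. relation with a given index is semidecided, relative to `A`,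
by an unbounded search for a zero of a total `A`-recursive function. -/
theorem exists_evalo_nonempty_W2 (A : Set ℕ) :
    ∃ (c : OCode) (d : ℕ → ℕ → ℕ), (∀ e n, evalo (chi A) c (Nat.pair e n) = Part.some (d e n)) ∧
      ∀ e, (∃ n, d e n = 0) ↔ (W2 A e).Nonempty := by
  obtain ⟨lk, hlk⟩ := exists_code_lookup
  obtain ⟨H, hH⟩ := exists_evalo_chiList A
  let F : ℕ → ℕ := fun m =>
    if (Code.evaln m.unpair.1.unpair.2.unpair.2.unpair.1
      (toCodeNat (lk.curry m.unpair.2) m.unpair.1.unpair.1)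
      m.unpair.1.unpair.2.unpair.2.unpair.2).isSome = true then 0 else 1
  have hF : Primrec F := by
    have h1 := Primrec.fst.comp Primrec.unpair
    have h2 := Primrec.snd.comp Primrec.unpair
    have h12 := h2.comp h1
    have h122 := h2.comp h12
    have hk := h1.comp h122
    have hx := h2.comp h122
    have he := h1.comp h1
    have hc := primrec_toCodeNat.comp (Code.primrec₂_curry.comp (Primrec.const lk) h2) he
    have hev := Code.primrec_evaln.comp ((hk.pair hc).pair hx)
    exact Primrec.ite (Primrec.eq.comp (Primrec.option_isSome.comp hev) (Primrec.const true))
      (Primrec.const 0) (Primrec.const 1)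
  obtain ⟨cF, hcF⟩ := Code.exists_code.1 (Partrec.nat_iff.1 hF.to_comp.partrec)
  refine ⟨.comp (OCode.ofCode cF) (.pair (.pair .left .right) (.comp H (.comp .left .right))),
    fun e n => F (Nat.pair (Nat.pair e n) (Encodable.encode (chiList A n.unpair.1))), ?_, ?_⟩
  · intro e n
    have hr : evalo (chi A) .right (Nat.pair e n) = Part.some n := by simp [evalo]
    have hl : evalo (chi A) (.pair .left .right) (Nat.pair e n) = Part.some (Nat.pair e n) := by
      rw [evalo_pair_of_eq rfl rfl, Nat.pair_unpair]
    have hh : evalo (chi A) (.comp H (.comp .left .right)) (Nat.pair e n) =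
        Part.some (Encodable.encode (chiList A n.unpair.1)) := by
      rw [evalo_comp_of_eq _ ((evalo_comp_of_eq _ hr).trans rfl), hH]
    rw [evalo_comp_of_eq _ (evalo_pair_of_eq hl hh), OCode.evalo_ofCode, hcF]
    rfl
  · intro e
    obtain ⟨c, rfl⟩ := encOCode_surjective e
    simp only [F, Nat.unpair_pair, toCodeNat_encOCode, ite_eq_left_iff, one_ne_zero, imp_false,
      not_not]
    constructor
    · rintro ⟨n, hn⟩
      refine ⟨n.unpair.2.unpair.2.unpair, c, rfl, ?_⟩
      rw [Nat.pair_unpair]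
      exact (exists_toCode_dom_iff A hlk c _).2 ⟨_, _, hn⟩
    · rintro ⟨x, c', hc', hx⟩
      obtain ⟨M, k, h⟩ := (exists_toCode_dom_iff A hlk c' _).1 hx
      refine ⟨Nat.pair M (Nat.pair k (Nat.pair x.1 x.2)), ?_⟩
      simp only [Nat.unpair_pair, ← toCodeNat_encOCode, ← hc']
      rwa [toCodeNat_encOCode]

theorem dom_mem_sigma01 {A : Set ℕ} {g : List Bool →. ℕ} (hg : RecInP A g) :
    {p | (g p).Dom} ∈ Sigma01 A := by
  obtain ⟨c, hc⟩ := hg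
  refine ⟨fun p => (g p).map fun _ => (), ⟨.comp .zero c, fun p => ?_⟩, rfl⟩
  simp only [evalo, hc, Part.bind_eq_bind, Part.map_map]
  exact Part.bind_some_eq_map (fun _ => 0) _ |>.trans (Part.map_map _ _ _)

theorem nonempty_W2_mem_sigma01 {A : Set ℕ} {g : List Bool →. ℕ} (hg : RecInP A g) :
    {p | ∃ e ∈ g p, (W2 A e).Nonempty} ∈ Sigma01 A := by
  obtain ⟨c, hc⟩ := hg
  obtain ⟨t, d, ht, hd⟩ := exists_evalo_nonempty_W2 A
  let r : ℕ →. ℕ := fun e => Nat.rfind fun n => Part.some (decide (d e n = 0))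
  have hr (e : ℕ) : (r e).Dom ↔ ∃ n, d e n = 0 := by
    refine Nat.rfind_dom.trans ?_
    simp
  have hrec : RecInP A fun p => (g p).bind r := by
    refine ⟨.comp (.rfind' t) (.pair c .zero), fun p => ?_⟩
    ext v
    simp [evalo, Seq.seq, hc, ht, r]
  convert dom_mem_sigma01 hrec using 1
  ext p
  simp only [Set.mem_ofPred_eq, ← hd, ← hr, Part.dom_iff_mem]
  refine Iff.trans ?_ (exists_congr fun v => Part.mem_bind_iff.symm)
  tauto

theorem zero_mem_pindex_iff {E : Set (ℕ × ℕ)} : 0 ∈ pindex E ↔ E = ∅ := by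
  constructor
  · rintro ⟨⟨hE, hfin⟩, h⟩
    have h0 : eqvClasses E = ∅ := (Set.ncard_eq_zero hfin).1 h
    refine Set.eq_empty_of_forall_notMem fun ⟨x, y⟩ hxy => ?_
    have : {z | (x, z) ∈ E} ∈ eqvClasses E := ⟨x, (hE.1 x y hxy).1, rfl⟩
    simp [h0] at this
  · rintro rfl
    have h0 : eqvClasses ∅ = ∅ := by simp [eqvClasses]
    exact ⟨⟨by simp [IsEqvRel], by simp [h0]⟩, by simp [pindex, h0]⟩

theorem zero_mem_Gidx_iff {A : Set ℕ} {g : List Bool →. ℕ} {p : List Bool} :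
    0 ∈ Gidx A g p ↔ (g p).Dom ∧ ¬ ∃ e ∈ g p, (W2 A e).Nonempty := by
  simp only [Gidx, Part.mem_bind_iff, zero_mem_pindex_iff]
  constructor
  · rintro ⟨e, he, h⟩
    refine ⟨Part.dom_iff_mem.2 ⟨e, he⟩, ?_⟩
    rintro ⟨e', he', h'⟩
    rw [Part.mem_unique he' he, h] at h'
    exact Set.not_nonempty_empty h'
  · rintro ⟨h, hn⟩
    exact ⟨_, Part.get_mem h, Set.not_nonempty_iff_eq_empty.1 fun h' => hn ⟨_, Part.get_mem h, h'⟩⟩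

theorem exists_zero_mem_Gidx_eq_inter {A : Set ℕ} {g : List Bool →. ℕ} (hg : RecInP A g) :
    ∃ S T : Set (List Bool), S ∈ Sigma01 A ∧ Tᶜ ∈ Sigma01 A ∧
      {p | (0 : ℕ) ∈ Gidx A g p} = S ∩ T := by
  refine ⟨_, {p | ∃ e ∈ g p, (W2 A e).Nonempty}ᶜ, dom_mem_sigma01 hg, ?_, ?_⟩
  · rw [compl_compl]
    exact nonempty_W2_mem_sigma01 hg
  · ext p
    exact zero_mem_Gidx_iff

open Classical in
theorem stmt14 (A : Set ℕ) :
    (∀ g : List Bool →. ℕ, RecInP A g →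
      ∃ S T : Set (List Bool), S ∈ Sigma01 A ∧ Tᶜ ∈ Sigma01 A ∧
        {p | (0 : ℕ) ∈ Gidx A g p} = S ∩ T) ∧
    (∀ X : Set (List Bool),
      RecInP (jump A) (fun p => Part.some (if p ∈ X then (0 : ℕ) else 1)) →
      ¬ BoolComb (Sigma01 A) X →
      ∀ g : List Bool →. ℕ, RecInP A g →
        (fun p => Part.some (if p ∈ X then (0 : ℕ) else 1)) ≠ Gidx A g) := by
  refine ⟨fun g hg => exists_zero_mem_Gidx_eq_inter hg, fun X _ hX g hg heq => hX ?_⟩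
  obtain ⟨S, T, hS, hT, hST⟩ := exists_zero_mem_Gidx_eq_inter hg
  have hXST : X = (Sᶜ ∪ Tᶜ)ᶜ := by
    rw [Set.compl_union, compl_compl, compl_compl, ← hST, ← heq]
    ext p
    by_cases hp : p ∈ X <;> simp [hp]
  rw [hXST]
  exact .compl (.union (.compl (.base hS)) (.base hT))
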